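/- arXiv:2301.03549 — 2 statements merged into one kernel-verified Lean document; each statement's English description precedes it below -/
import Mathlib

section
/- Integral representation for the absolute value of a resolvent (Section 5). Let H be a Hermitian matrix and G(w) = (H−w)^{-1}. Then for every w = e + iη ∈ C∖R, the absolute value of the resolvent satisfies |G(e+iη)| = (2/π)·∫₀^∞ Im G(e + i·√(η²+s²))·ds/√(η²+s²), where |G| := (G·G*)^{1/2} is defined by the functional calculus and Im G := (G − G*)/(2i). -/
open MeasureTheory Matrix Filter Topology
open scoped ComplexOrder

noncomputable section

/-- Index type for `2N × 2N` block matrices. -/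
abbrev Idx (N : ℕ) := Fin N ⊕ Fin N

/-- Square `2N × 2N` complex matrices. -/
abbrev Mat2 (N : ℕ) := Matrix (Idx N) (Idx N) ℂ

/-- Normalised trace `⟨A⟩ = (dim)⁻¹ Tr A`. -/
def ntr {n : Type*} [Fintype n] (A : Matrix n n ℂ) : ℂ :=
  (Fintype.card n : ℂ)⁻¹ * A.trace

/-- The block matrix `E₋ = [[1,0],[0,-1]]`. -/
def Em (N : ℕ) : Mat2 N :=
  Matrix.fromBlocks 1 0 0 (-1)

/-- The self-energy operator `S[T] = ⟨T E₊⟩E₊ − ⟨T E₋⟩E₋`. -/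
def Sop (N : ℕ) (T : Mat2 N) : Mat2 N :=
  ntr T • (1 : Mat2 N) - ntr (T * Em N) • Em N

/-- Imaginary part of a matrix, `Im A = (A − A*)/(2i)`. -/
def matIm {n : Type*} (A : Matrix n n ℂ) : Matrix n n ℂ :=
  (2 * Complex.I)⁻¹ • (A - Aᴴ)

/-- Hermitisation `[[0, Y],[Y*, 0]]`. -/
def herm {N : ℕ} (Y : Matrix (Fin N) (Fin N) ℂ) : Mat2 N :=
  Matrix.fromBlocks 0 Y Yᴴ 0

/-- Resolvent `(H − w)⁻¹`. -/
def resv {n : Type*} [Fintype n] [DecidableEq n]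
    (H : Matrix n n ℂ) (w : ℂ) : Matrix n n ℂ :=
  (H - w • 1)⁻¹

/-- The `ℓ² → ℓ²` operator norm of a matrix. -/
def opNorm {m n : Type*} [Fintype m] [Fintype n] [DecidableEq n]
    (A : Matrix m n ℂ) : ℝ :=
  ‖LinearMap.toContinuousLinearMap (Matrix.toEuclideanLin A)‖

/-- Euclidean norm of a vector. -/
def vnorm {n : Type*} [Fintype n] (x : n → ℂ) : ℝ :=
  Real.sqrt (∑ a, ‖x a‖ ^ 2)

/-- The law of a normalised i.i.d. matrix entry: centred, unit variance,
vanishing second moment, and all moments finite. -/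
structure IsIIDLaw (μ : Measure ℂ) : Prop where
  prob : IsProbabilityMeasure μ
  moments : ∀ p : ℕ, Integrable (fun z : ℂ => ‖z‖ ^ p) μ
  mean_zero : ∫ z, z ∂μ = 0
  unit_variance : ∫ z, ‖z‖ ^ 2 ∂μ = 1
  second_moment_zero : ∫ z, z ^ 2 ∂μ = 0

/-- `X` has independent entries, each distributed as `N^{-1/2}·χ` where `χ ∼ μ`. -/
def HasIIDEntries (N : ℕ) {Ω : Type*} [MeasureSpace Ω]
    (μ : Measure ℂ) (X : Ω → Matrix (Fin N) (Fin N) ℂ) : Prop :=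
  Measure.map (fun ω => fun p : Fin N × Fin N => X ω p.1 p.2) volume
    = Measure.pi fun _ : Fin N × Fin N =>
        Measure.map (fun z : ℂ => ((((N : ℝ) ^ (-(1/2 : ℝ))) : ℝ) : ℂ) * z) μ

/-- Stochastic domination `X ≺ Y` for `N`-indexed families of random variables,
uniformly in a parameter `u : U N`. -/
def StochDom (Ω : ℕ → Type*) [∀ N, MeasureSpace (Ω N)]
    (U : ℕ → Type*) (X Y : (N : ℕ) → U N → Ω N → ℝ) : Prop :=
  ∀ ε : ℝ, 0 < ε → ∀ D : ℝ, 0 < D → ∃ N₀ : ℕ, ∀ N : ℕ, N₀ ≤ N → ∀ u : U N,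
    volume {ω : Ω N | (N : ℝ) ^ ε * Y N u ω < X N u ω}
      ≤ ENNReal.ofReal ((N : ℝ) ^ (-D))

/-- `M` solves the Matrix Dyson Equation `−M(w)⁻¹ = w − Λ̂ + S[M(w)]`
with `Im M(w)·Im w > 0`. -/
def IsMDESolution (N : ℕ) (Λ : Matrix (Fin N) (Fin N) ℂ)
    (M : ℂ → Mat2 N) : Prop :=
  ∀ w : ℂ, w.im ≠ 0 →
    M w * (w • (1 : Mat2 N) - herm Λ + Sop N (M w)) = -1 ∧
    (w.im • matIm (M w)).PosDef

/-- The scalar self-consistent equation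
`m(w) = ∫ μ_Λ̂(de)/(e − (w + m(w))) = ⟨(Λ̂ − (w+m(w)))⁻¹⟩`, `Im m·Im w > 0`. -/
def IsScalarDyson (N : ℕ) (Λ : Matrix (Fin N) (Fin N) ℂ) (m : ℂ → ℂ) : Prop :=
  ∀ w : ℂ, w.im ≠ 0 →
    m w = ntr ((herm Λ - (w + m w) • (1 : Mat2 N))⁻¹) ∧
    0 < (m w).im * w.im

section UnitaryConjugation

variable {n : Type*} [Fintype n] [DecidableEq n] {U : Matrix n n ℂ}

lemma conj_diagonal_mul_conj_diagonal (hU : U ∈ unitaryGroup n ℂ) (a b : n → ℂ) :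
    (U * diagonal a * Uᴴ) * (U * diagonal b * Uᴴ) = U * diagonal (fun i => a i * b i) * Uᴴ := by
  have h : Uᴴ * U = 1 := mem_unitaryGroup_iff'.mp hU
  calc (U * diagonal a * Uᴴ) * (U * diagonal b * Uᴴ)
      = U * diagonal a * (Uᴴ * U) * diagonal b * Uᴴ := by simp only [Matrix.mul_assoc]
    _ = _ := by rw [h, Matrix.mul_one, Matrix.mul_assoc U, diagonal_mul_diagonal]

lemma conjTranspose_conj_diagonal (U : Matrix n n ℂ) (a : n → ℂ) :
    (U * diagonal a * Uᴴ)ᴴ = U * diagonal (fun i => star (a i)) * Uᴴ := by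
  simp only [conjTranspose_mul, conjTranspose_conjTranspose, diagonal_conjTranspose,
    Matrix.mul_assoc]
  rfl

lemma conj_diagonal_apply (U : Matrix n n ℂ) (a : n → ℂ) (p q : n) :
    (U * diagonal a * Uᴴ) p q = ∑ k, a k * (U p k * star (U q k)) := by
  rw [Matrix.mul_apply]
  refine Finset.sum_congr rfl fun k _ => ?_
  rw [mul_diagonal, conjTranspose_apply]
  ring

lemma resv_conj_diagonal (hU : U ∈ unitaryGroup n ℂ) (a : n → ℂ) (w : ℂ) (hw : ∀ i, a i ≠ w) :
    resv (U * diagonal a * Uᴴ) w = U * diagonal (fun i => (a i - w)⁻¹) * Uᴴ := by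
  have h : U * Uᴴ = 1 := mem_unitaryGroup_iff.mp hU
  have hsub : U * diagonal a * Uᴴ - w • 1 = U * diagonal (fun i => a i - w) * Uᴴ := by
    rw [← h, ← diagonal_sub a (fun _ => w), Matrix.mul_sub, Matrix.sub_mul]
    congr 1
    rw [← smul_one_eq_diagonal]
    simp
  rw [resv, hsub]
  refine inv_eq_right_inv ?_
  rw [conj_diagonal_mul_conj_diagonal hU]
  simp [mul_inv_cancel₀ (sub_ne_zero.mpr (hw _)), h]

lemma matIm_conj_diagonal (U : Matrix n n ℂ) (a : n → ℂ) :
    matIm (U * diagonal a * Uᴴ) = U * diagonal (fun i => ((a i).im : ℂ)) * Uᴴ := by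
  ext p q
  rw [matIm, conjTranspose_conj_diagonal, Matrix.smul_apply, Matrix.sub_apply]
  simp only [conj_diagonal_apply, smul_eq_mul]
  rw [← Finset.sum_sub_distrib, Finset.mul_sum]
  refine Finset.sum_congr rfl fun k _ => ?_
  rw [← sub_mul, ← mul_assoc, Complex.star_def, Complex.sub_conj]
  field_simp
  push_cast
  ring

lemma posSemidef_conj_diagonal (U : Matrix n n ℂ) {a : n → ℂ} (ha : ∀ i, 0 ≤ a i) :
    (U * diagonal a * Uᴴ).PosSemidef :=
  (PosSemidef.diagonal ha).mul_mul_conjTranspose_same U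

end UnitaryConjugation

section

open scoped MatrixOrder Matrix.Norms.L2Operator

lemma Matrix.PosSemidef.eq_of_mul_self_eq {n : Type*} [Fintype n] [DecidableEq n]
    {A B : Matrix n n ℂ} (hA : A.PosSemidef) (hB : B.PosSemidef) (h : A * A = B * B) : A = B :=
  (CFC.mul_self_eq_mul_self_iff A B hA.nonneg hB.nonneg).mp h

end

lemma inv_sq_add_sq_eq {c : ℝ} (hc : 0 < c) (s : ℝ) :
    (c ^ 2 + s ^ 2)⁻¹ = (c ^ 2)⁻¹ * (1 + (c⁻¹ * s) ^ 2)⁻¹ := by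
  field_simp

lemma integrable_inv_sq_add_sq {c : ℝ} (hc : 0 < c) :
    Integrable fun s : ℝ => (c ^ 2 + s ^ 2)⁻¹ := by
  simp_rw [inv_sq_add_sq_eq hc]
  exact (integrable_inv_one_add_sq.comp_mul_left' (inv_ne_zero hc.ne')).const_mul _

lemma integral_Ioi_inv_sq_add_sq {c : ℝ} (hc : 0 < c) :
    ∫ s in Set.Ioi (0 : ℝ), (c ^ 2 + s ^ 2)⁻¹ = Real.pi / 2 * c⁻¹ := by
  simp_rw [inv_sq_add_sq_eq hc]
  rw [integral_const_mul, integral_comp_mul_left_Ioi (fun x => (1 + x ^ 2)⁻¹) 0 (inv_pos.mpr hc),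
    mul_zero, integral_Ioi_inv_one_add_sq, Real.arctan_zero, smul_eq_mul]
  field_simp
  ring

/-- The **scalar integral representation** of `1 / |x - w|`. -/
lemma inv_norm_sub_eq_integral (x : ℝ) {w : ℂ} (hw : w.im ≠ 0) :
    ‖(x : ℂ) - w‖⁻¹ =
      2 / Real.pi * ∫ s in Set.Ioi (0 : ℝ), (‖(x : ℂ) - w‖ ^ 2 + s ^ 2)⁻¹ := by
  have hc : 0 < ‖(x : ℂ) - w‖ := norm_pos_iff.mpr fun h => hw (by simpa using congrArg Complex.im h)
  rw [integral_Ioi_inv_sq_add_sq hc]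
  field_simp

lemma inv_sqrt_mul_im_inv_sub (x s : ℝ) {w : ℂ} (hw : w.im ≠ 0) :
    (√(w.im ^ 2 + s ^ 2))⁻¹ *
        (((x : ℂ) - ((w.re : ℂ) + ((√(w.im ^ 2 + s ^ 2) : ℝ) : ℂ) * Complex.I))⁻¹).im =
      (‖(x : ℂ) - w‖ ^ 2 + s ^ 2)⁻¹ := by
  have hpos : 0 < w.im ^ 2 + s ^ 2 := by positivity
  have ht : 0 < √(w.im ^ 2 + s ^ 2) := Real.sqrt_pos.mpr hpos
  have hsq := Real.sq_sqrt hpos.le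
  have hden : Complex.normSq ((x : ℂ) - ((w.re : ℂ) + ((√(w.im ^ 2 + s ^ 2) : ℝ) : ℂ) * Complex.I))
      = ‖(x : ℂ) - w‖ ^ 2 + s ^ 2 := by
    rw [← Complex.normSq_eq_norm_sq, Complex.normSq_apply, Complex.normSq_apply]
    simp
    linear_combination hsq
  rw [Complex.inv_im, hden]
  simp [← mul_div_assoc, inv_mul_cancel₀ ht.ne']

/-- **Integral representation for the absolute value of a resolvent** (Section 5):
for Hermitian `H` and `w = e + iη ∈ ℂ∖ℝ`,
`|G(e+iη)| = (2/π)∫₀^∞ Im G(e + i√(η²+s²)) ds/√(η²+s²)`,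
where `|G| = (GG*)^{1/2}` is characterised as the positive semidefinite square
root of `G G*`. -/
theorem abs_resolvent_integral_representation
    {n : Type*} [Fintype n] [DecidableEq n]
    (H : Matrix n n ℂ) (hH : H.IsHermitian)
    (w : ℂ) (hw : w.im ≠ 0)
    (P : Matrix n n ℂ) (hP : P.PosSemidef)
    (hPsq : P * P = resv H w * (resv H w)ᴴ) :
    ∀ p q : n,
      P p q = ((2 / Real.pi : ℝ) : ℂ) *
        ∫ s in Set.Ioi (0 : ℝ),
          (((Real.sqrt (w.im ^ 2 + s ^ 2))⁻¹ : ℝ) : ℂ) *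
            matIm (resv H ((w.re : ℂ) +
              ((Real.sqrt (w.im ^ 2 + s ^ 2) : ℝ) : ℂ) * Complex.I)) p q := by
  intro p q
  obtain ⟨U, hU, x, rfl⟩ : ∃ U ∈ unitaryGroup n ℂ, ∃ x : n → ℝ,
      H = U * diagonal (fun i => (x i : ℂ)) * Uᴴ :=
    ⟨hH.eigenvectorUnitary, hH.eigenvectorUnitary.2, hH.eigenvalues, by
      conv_lhs => rw [hH.spectral_theorem, Unitary.conjStarAlgAut_apply]
      rfl⟩
  have hne : ∀ {z : ℂ}, z.im ≠ 0 → ∀ i, (x i : ℂ) ≠ z := fun hz i h =>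
    hz (by rw [← h, Complex.ofReal_im])
  have hP_eq : P = U * diagonal (fun i => ((‖(x i : ℂ) - w‖⁻¹ : ℝ) : ℂ)) * Uᴴ := by
    refine hP.eq_of_mul_self_eq (posSemidef_conj_diagonal U fun i => ?_) ?_
    · exact Complex.zero_le_real.mpr (by positivity)
    · rw [hPsq, resv_conj_diagonal hU _ w (hne hw), conjTranspose_conj_diagonal,
        conj_diagonal_mul_conj_diagonal hU, conj_diagonal_mul_conj_diagonal hU]
      congr 3
      funext i
      rw [Complex.star_def, Complex.mul_conj, Complex.normSq_eq_norm_sq, norm_inv]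
      push_cast
      ring
  have hint : ∀ s : ℝ, (((√(w.im ^ 2 + s ^ 2))⁻¹ : ℝ) : ℂ) *
      matIm (resv (U * diagonal (fun i => (x i : ℂ)) * Uᴴ)
        ((w.re : ℂ) + ((√(w.im ^ 2 + s ^ 2) : ℝ) : ℂ) * Complex.I)) p q =
      ∑ k, (((‖(x k : ℂ) - w‖ ^ 2 + s ^ 2)⁻¹ : ℝ) : ℂ) * (U p k * star (U q k)) := by
    intro s
    have ht : √(w.im ^ 2 + s ^ 2) ≠ 0 := by positivity
    rw [resv_conj_diagonal hU _ _ (hne (by simpa using ht)), matIm_conj_diagonal,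
      conj_diagonal_apply, Finset.mul_sum]
    refine Finset.sum_congr rfl fun k _ => ?_
    rw [← mul_assoc, ← Complex.ofReal_mul, inv_sqrt_mul_im_inv_sub (x k) s hw]
  have hc : ∀ k, 0 < ‖(x k : ℂ) - w‖ := fun k =>
    norm_pos_iff.mpr (sub_ne_zero.mpr (hne hw k))
  simp_rw [hint]
  rw [integral_finsetSum _ fun k _ =>
    ((integrable_inv_sq_add_sq (hc k)).integrableOn.ofReal.mul_const _), hP_eq,
    conj_diagonal_apply, Finset.mul_sum]
  refine Finset.sum_congr rfl fun k _ => ?_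
  rw [integral_mul_const, integral_complex_ofReal, inv_norm_sub_eq_integral (x k) hw,
    Complex.ofReal_mul, mul_assoc]
end
end

section
/- Spectral properties of the two-body stability operator (Appendix B, Lemma on the stability operator). Let w_1, w_2 ∈ C∖R and M_1, M_2 be the corresponding MDE solutions. (a) The stability operator B = 1 − M_1·S[·]·M_2 on C^{2N×2N} has (2N)² − 2 eigenvalues equal to 1 and two nontrivial eigenvalues β_± = 1 ∓ ⟨M_1 E_± M_2 E_±⟩, with right eigenvectors R_± = M_1 E_± M_2 and left eigenvectors L_± = E_± (up to normalisation so that ⟨L_±, R_±⟩ = 1). (b) |β_±| ≳ (|Re w_1 ∓ Re w_2| + |Im w_1| + |Im w_2|) ∧ 1; in particular B is invertible. (c) Fix κ > 0 and set s := −sgn(Im w_1·Im w_2); if Re w_1, Re w_2 ∈ B_κ, then |β_{−s}| ≳ 1. -/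
open MeasureTheory Matrix Filter Topology
open scoped ComplexOrder

noncomputable section

/-- The normalised squared Hilbert–Schmidt norm `⟨A A*⟩`. -/
def hsSq {n : Type*} [Fintype n] (A : Matrix n n ℂ) : ℝ :=
  (Fintype.card n : ℝ)⁻¹ * ∑ i, ∑ j, ‖A i j‖ ^ 2

/-- `A = (H - w - ⟨A⟩)⁻¹` with `Im ⟨A⟩ · Im w > 0`. -/
structure IsDysonResolvent {n : Type*} [Fintype n] [DecidableEq n]
    (H : Matrix n n ℂ) (w : ℂ) (A : Matrix n n ℂ) : Prop where
  mul_eq_one : A * (H - (w + ntr A) • 1) = 1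
  im_pos : 0 < w.im * (ntr A).im

section NormalisedTrace

variable {n : Type*} [Fintype n]

lemma ntr_add (A B : Matrix n n ℂ) : ntr (A + B) = ntr A + ntr B := by
  simp [ntr, Matrix.trace_add, mul_add]

lemma ntr_sub (A B : Matrix n n ℂ) : ntr (A - B) = ntr A - ntr B := by
  simp [ntr, Matrix.trace_sub, mul_sub]

lemma ntr_neg (A : Matrix n n ℂ) : ntr (-A) = -ntr A := by
  simp [ntr, Matrix.trace_neg]

lemma ntr_smul (c : ℂ) (A : Matrix n n ℂ) : ntr (c • A) = c * ntr A := by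
  simp [ntr, Matrix.trace_smul]; ring

lemma ntr_mul_comm (A B : Matrix n n ℂ) : ntr (A * B) = ntr (B * A) := by
  simp [ntr, Matrix.trace_mul_comm A B]

lemma ntr_conjTranspose (A : Matrix n n ℂ) : ntr Aᴴ = starRingEnd ℂ (ntr A) := by
  simp [ntr, Matrix.trace_conjTranspose]

lemma ntr_mul_conjTranspose_self (A : Matrix n n ℂ) : ntr (A * Aᴴ) = (hsSq A : ℂ) := by
  simp [ntr, hsSq, Matrix.trace, Matrix.mul_apply, Complex.mul_conj, Complex.normSq_eq_norm_sq]

lemma hsSq_sub_conjTranspose (A B : Matrix n n ℂ) :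
    hsSq (A - Bᴴ) = hsSq A + hsSq B - 2 * (ntr (A * B)).re := by
  have hBA : ntr (Bᴴ * Aᴴ) = starRingEnd ℂ (ntr (A * B)) := by
    rw [← Matrix.conjTranspose_mul, ntr_conjTranspose]
  have hBB : ntr (Bᴴ * B) = (hsSq B : ℂ) := by
    rw [ntr_mul_comm, ntr_mul_conjTranspose_self]
  have h : (hsSq (A - Bᴴ) : ℂ) =
      hsSq A + hsSq B - (ntr (A * B) + starRingEnd ℂ (ntr (A * B))) := by
    rw [← ntr_mul_conjTranspose_self, Matrix.conjTranspose_sub,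
      Matrix.conjTranspose_conjTranspose, sub_mul, mul_sub, mul_sub, ntr_sub, ntr_sub, ntr_sub,
      ntr_mul_conjTranspose_self, hBA, hBB]
    ring
  have := congrArg Complex.re h
  simp at this
  linarith

lemma norm_ntr_mul_le (A B : Matrix n n ℂ) : ‖ntr (A * B)‖ ≤ (hsSq A + hsSq B) / 2 := by
  have hB : hsSq B = (Fintype.card n : ℝ)⁻¹ * ∑ i, ∑ j, ‖B j i‖ ^ 2 := by
    rw [hsSq, Finset.sum_comm]
  rw [hB, hsSq, ntr, norm_mul, norm_inv, Complex.norm_natCast, ← mul_add, mul_div_assoc]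
  refine mul_le_mul_of_nonneg_left ?_ (by positivity)
  rw [← Finset.sum_add_distrib, Finset.sum_div]
  refine (norm_sum_le _ _).trans (Finset.sum_le_sum fun i _ => ?_)
  rw [Matrix.diag_apply, Matrix.mul_apply, ← Finset.sum_add_distrib, Finset.sum_div]
  refine (norm_sum_le _ _).trans (Finset.sum_le_sum fun j _ => ?_)
  rw [norm_mul]
  nlinarith [sq_nonneg (‖A i j‖ - ‖B j i‖)]

lemma norm_ntr_sq_le_hsSq (A : Matrix n n ℂ) : ‖ntr A‖ ^ 2 ≤ hsSq A := by
  rcases isEmpty_or_nonempty n with hn | hn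
  · simp [ntr, hsSq]
  have hc : (0 : ℝ) < Fintype.card n := by exact_mod_cast Fintype.card_pos
  have hdiag : ∑ i, ‖A i i‖ ^ 2 ≤ ∑ i, ∑ j, ‖A i j‖ ^ 2 :=
    Finset.sum_le_sum fun i _ =>
      Finset.single_le_sum (f := fun j => ‖A i j‖ ^ 2) (fun j _ => by positivity)
        (Finset.mem_univ i)
  have hcs : (∑ i, ‖A i i‖) ^ 2 ≤ Fintype.card n * ∑ i, ‖A i i‖ ^ 2 :=
    sq_sum_le_card_mul_sum_sq
  have htr : ‖A.trace‖ ^ 2 ≤ (∑ i, ‖A i i‖) ^ 2 :=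
    pow_le_pow_left₀ (norm_nonneg _) (norm_sum_le _ _) 2
  rw [ntr, hsSq, norm_mul, norm_inv, Complex.norm_natCast, mul_pow]
  calc ((Fintype.card n : ℝ)⁻¹) ^ 2 * ‖A.trace‖ ^ 2
      ≤ ((Fintype.card n : ℝ)⁻¹) ^ 2 * (Fintype.card n * ∑ i, ∑ j, ‖A i j‖ ^ 2) := by
        gcongr
        exact htr.trans (hcs.trans (by gcongr))
    _ = _ := by field_simp

end NormalisedTrace

namespace IsDysonResolvent

variable {n : Type*} [Fintype n] [DecidableEq n] {H : Matrix n n ℂ} {w w₁ w₂ : ℂ}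
  {A A₁ A₂ : Matrix n n ℂ}

lemma sub_mul_eq_one (h : IsDysonResolvent H w A) : (H - (w + ntr A) • 1) * A = 1 :=
  mul_eq_one_comm.mp h.mul_eq_one

lemma im_ne_zero (h : IsDysonResolvent H w A) : w.im ≠ 0 := by
  rintro h0
  simpa [h0] using h.im_pos

lemma conjTranspose (hH : H.IsHermitian) (h : IsDysonResolvent H w A) :
    IsDysonResolvent H (starRingEnd ℂ w) Aᴴ where
  mul_eq_one := by
    have := congrArg Matrix.conjTranspose h.sub_mul_eq_one
    rw [ntr_conjTranspose, ← map_add]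
    simpa [Matrix.conjTranspose_mul, hH.eq] using this
  im_pos := by
    simpa [ntr_conjTranspose] using h.im_pos

lemma sub_eq_smul_mul (h₁ : IsDysonResolvent H w₁ A₁) (h₂ : IsDysonResolvent H w₂ A₂) :
    A₁ - A₂ = ((w₁ + ntr A₁) - (w₂ + ntr A₂)) • (A₁ * A₂) := by
  have e : ((w₁ + ntr A₁) - (w₂ + ntr A₂)) • (1 : Matrix n n ℂ) =
      (H - (w₂ + ntr A₂) • 1) - (H - (w₁ + ntr A₁) • 1) := by
    rw [sub_smul]; abel
  calc A₁ - A₂ = A₁ * ((H - (w₂ + ntr A₂) • 1) * A₂) - (A₁ * (H - (w₁ + ntr A₁) • 1)) * A₂ := by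
        rw [h₁.mul_eq_one, h₂.sub_mul_eq_one, mul_one, one_mul]
    _ = A₁ * (((w₁ + ntr A₁) - (w₂ + ntr A₂)) • (1 : Matrix n n ℂ)) * A₂ := by
        rw [e]; noncomm_ring
    _ = _ := by simp

lemma ntr_sub_mul (h₁ : IsDysonResolvent H w₁ A₁) (h₂ : IsDysonResolvent H w₂ A₂) :
    (1 - ntr (A₁ * A₂)) * (ntr A₁ - ntr A₂) = (w₁ - w₂) * ntr (A₁ * A₂) := by
  have := congrArg ntr (h₁.sub_eq_smul_mul h₂)
  rw [ntr_sub, ntr_smul] at this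
  linear_combination this

lemma im_ntr_eq (hH : H.IsHermitian) (h : IsDysonResolvent H w A) :
    (ntr A).im = (w.im + (ntr A).im) * hsSq A := by
  have := congrArg ntr (h.sub_eq_smul_mul (h.conjTranspose hH))
  rw [ntr_sub, ntr_smul, ntr_mul_conjTranspose_self, ntr_conjTranspose] at this
  have := congrArg Complex.im this
  simp at this
  linarith

lemma abs_im_ntr_eq (hH : H.IsHermitian) (h : IsDysonResolvent H w A) :
    |(ntr A).im| = (|w.im| + |(ntr A).im|) * hsSq A := by
  have h1 := h.im_ntr_eq hH
  rcases pos_and_pos_or_neg_and_neg_of_mul_pos h.im_pos with ⟨ha, hb⟩ | ⟨ha, hb⟩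
  · rwa [abs_of_pos ha, abs_of_pos hb]
  · rw [abs_of_neg ha, abs_of_neg hb]; linarith

lemma hsSq_le_one (hH : H.IsHermitian) (h : IsDysonResolvent H w A) : hsSq A ≤ 1 := by
  have h1 := h.abs_im_ntr_eq hH
  have h2 : 0 < |w.im| := abs_pos.mpr h.im_ne_zero
  by_contra! hc
  nlinarith [abs_nonneg (ntr A).im]

lemma norm_ntr_le_one (hH : H.IsHermitian) (h : IsDysonResolvent H w A) : ‖ntr A‖ ≤ 1 := by
  have := norm_ntr_sq_le_hsSq A
  have := h.hsSq_le_one hH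
  nlinarith

lemma min_le_one_sub_hsSq (hH : H.IsHermitian) (h : IsDysonResolvent H w A) :
    min |w.im| 1 / 2 ≤ 1 - hsSq A := by
  have h1 := h.abs_im_ntr_eq hH
  have h2 : 0 < |w.im| := abs_pos.mpr h.im_ne_zero
  have h3 : |(ntr A).im| ≤ 1 := (Complex.abs_im_le_norm _).trans (h.norm_ntr_le_one hH)
  have h4 : 0 ≤ 1 - hsSq A := sub_nonneg.mpr (h.hsSq_le_one hH)
  have h5 : |w.im| ≤ (|w.im| + 1) * (1 - hsSq A) := by nlinarith
  rcases le_total |w.im| 1 with h6 | h6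
  · rw [min_eq_left h6]; nlinarith
  · rw [min_eq_right h6]; nlinarith

lemma norm_ntr_mul_le_one (hH : H.IsHermitian) (h₁ : IsDysonResolvent H w₁ A₁)
    (h₂ : IsDysonResolvent H w₂ A₂) : ‖ntr (A₁ * A₂)‖ ≤ 1 := by
  linarith [norm_ntr_mul_le A₁ A₂, h₁.hsSq_le_one hH, h₂.hsSq_le_one hH]

lemma min_abs_im_le (hH : H.IsHermitian) (h₁ : IsDysonResolvent H w₁ A₁)
    (h₂ : IsDysonResolvent H w₂ A₂) :
    (min |w₁.im| 1 + min |w₂.im| 1) / 4 ≤ ‖1 - ntr (A₁ * A₂)‖ := by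
  have h := norm_sub_norm_le (1 : ℂ) (ntr (A₁ * A₂))
  rw [norm_one] at h
  linarith [norm_ntr_mul_le A₁ A₂, h₁.min_le_one_sub_hsSq hH, h₂.min_le_one_sub_hsSq hH]

lemma min_abs_re_le (hH : H.IsHermitian) (h₁ : IsDysonResolvent H w₁ A₁)
    (h₂ : IsDysonResolvent H w₂ A₂) :
    min |w₁.re - w₂.re| 1 / 3 ≤ ‖1 - ntr (A₁ * A₂)‖ := by
  set b := ‖1 - ntr (A₁ * A₂)‖ with hb
  have hb0 : 0 ≤ b := norm_nonneg _
  have e : w₁ - w₂ = (1 - ntr (A₁ * A₂)) * ((w₁ - w₂) + (ntr A₁ - ntr A₂)) := by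
    linear_combination - h₁.ntr_sub_mul h₂
  have h3 : ‖w₁ - w₂‖ ≤ b * (‖w₁ - w₂‖ + 2) := by
    conv_lhs => rw [e, norm_mul]
    refine mul_le_mul_of_nonneg_left ((norm_add_le _ _).trans ?_) hb0
    linarith [norm_sub_le (ntr A₁) (ntr A₂), h₁.norm_ntr_le_one hH, h₂.norm_ntr_le_one hH]
  have h4 : |w₁.re - w₂.re| ≤ ‖w₁ - w₂‖ := by
    simpa using Complex.abs_re_le_norm (w₁ - w₂)
  rcases le_total ‖w₁ - w₂‖ 1 with h6 | h6
  · have := min_le_left |w₁.re - w₂.re| 1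
    nlinarith
  · have := min_le_right |w₁.re - w₂.re| 1
    nlinarith

/-- Lower bound on the nontrivial eigenvalue `1 - ⟨A₁A₂⟩` away from the diagonal. -/
lemma le_norm_one_sub_ntr_mul (hH : H.IsHermitian) (h₁ : IsDysonResolvent H w₁ A₁)
    (h₂ : IsDysonResolvent H w₂ A₂) :
    1 / 7 * min (|w₁.re - w₂.re| + |w₁.im| + |w₂.im|) 1 ≤ ‖1 - ntr (A₁ * A₂)‖ := by
  have hmin : ∀ a b c : ℝ, 0 ≤ a → 0 ≤ b → 0 ≤ c →
      min (a + b + c) 1 ≤ min a 1 + (min b 1 + min c 1) := by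
    intro a b c ha hb hc
    rcases min_cases a 1 with ⟨e1, _⟩ | ⟨e1, _⟩ <;> rcases min_cases b 1 with ⟨e2, _⟩ | ⟨e2, _⟩ <;>
      rcases min_cases c 1 with ⟨e3, _⟩ | ⟨e3, _⟩ <;>
      rcases min_cases (a + b + c) 1 with ⟨e4, _⟩ | ⟨e4, _⟩ <;> linarith
  linarith [hmin _ _ _ (abs_nonneg (w₁.re - w₂.re)) (abs_nonneg w₁.im) (abs_nonneg w₂.im),
    h₁.min_abs_im_le hH h₂, h₁.min_abs_re_le hH h₂]

lemma im_ntr_mul_im_ntr_pos (h₁ : IsDysonResolvent H w₁ A₁) (h₂ : IsDysonResolvent H w₂ A₂)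
    (hw : 0 < w₁.im * w₂.im) : 0 < (ntr A₁).im * (ntr A₂).im := by
  have := mul_pos h₁.im_pos h₂.im_pos
  refine pos_of_mul_pos_right (a := w₁.im * w₂.im) ?_ hw.le
  linarith

/-- For spectral parameters in the same half-plane, `1 - ⟨A₁A₂⟩` is controlled by `Im ⟨A₁⟩`. -/
lemma sq_im_le_norm_one_sub_ntr_mul (hH : H.IsHermitian) (h₁ : IsDysonResolvent H w₁ A₁)
    (h₂ : IsDysonResolvent H w₂ A₂) (hw : 0 < w₁.im * w₂.im) :
    (ntr A₁).im ^ 2 / 2 ≤ ‖1 - ntr (A₁ * A₂)‖ := by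
  have hpos := h₁.im_ntr_mul_im_ntr_pos h₂ hw
  have hre : 1 - (ntr (A₁ * A₂)).re ≤ ‖1 - ntr (A₁ * A₂)‖ := by
    simpa using Complex.re_le_norm (1 - ntr (A₁ * A₂))
  have him : ((ntr A₁).im + (ntr A₂).im) ^ 2 ≤ ‖ntr (A₁ - A₂ᴴ)‖ ^ 2 := by
    rw [← sq_abs]
    refine pow_le_pow_left₀ (abs_nonneg _) ?_ 2
    simpa [ntr_sub, ntr_conjTranspose] using Complex.abs_im_le_norm (ntr (A₁ - A₂ᴴ))
  nlinarith [norm_ntr_sq_le_hsSq (A₁ - A₂ᴴ), hsSq_sub_conjTranspose A₁ A₂,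
    h₁.hsSq_le_one hH, h₂.hsSq_le_one hH]

lemma sq_im_mul_norm_ntr_sub_le (hH : H.IsHermitian) (h₁ : IsDysonResolvent H w₁ A₁)
    (h₂ : IsDysonResolvent H w₂ A₂) (hw : 0 < w₁.im * w₂.im) :
    (ntr A₁).im ^ 2 / 2 * ‖ntr A₁ - ntr A₂‖ ≤ ‖w₁ - w₂‖ := by
  have e := congrArg norm (h₁.ntr_sub_mul h₂)
  rw [norm_mul, norm_mul] at e
  have h3 := h₁.sq_im_le_norm_one_sub_ntr_mul hH h₂ hw
  calc _ ≤ ‖1 - ntr (A₁ * A₂)‖ * ‖ntr A₁ - ntr A₂‖ := by gcongr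
    _ = ‖w₁ - w₂‖ * ‖ntr (A₁ * A₂)‖ := e
    _ ≤ ‖w₁ - w₂‖ * 1 := by gcongr; exact h₁.norm_ntr_mul_le_one hH h₂
    _ = _ := mul_one _

/-- If the boundary value of `⟨A⟩` at `Re w` has imaginary part at least `δ`, then so does `⟨A⟩`
itself, up to an error of order `|Im w|`. -/
lemma le_abs_im_ntr_of_tendsto (hH : H.IsHermitian) (h : IsDysonResolvent H w A)
    {G : ℂ → Matrix n n ℂ} (hG : ∀ z : ℂ, z.im ≠ 0 → IsDysonResolvent H z (G z)) {b : ℂ} {δ : ℝ}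
    (hδ : 0 < δ) (hb : δ ≤ b.im)
    (hlim : Tendsto (fun η : ℝ => ntr (G ((w.re : ℂ) + (η : ℂ) * Complex.I)))
      (nhdsWithin 0 (Set.Ioi 0)) (nhds b)) :
    δ - 2 * |w.im| / δ ^ 2 ≤ |(ntr A).im| := by
  wlog hw : 0 < w.im generalizing w A
  · have h' := this (h.conjTranspose hH) (by simpa using hlim)
      (by simpa using lt_of_le_of_ne (not_lt.mp hw) h.im_ne_zero)
    simpa [ntr_conjTranspose] using h'
  have hL : Tendsto (fun η : ℝ => (ntr (G ((w.re : ℂ) + (η : ℂ) * Complex.I))).im ^ 2 / 2 *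
      ‖ntr (G ((w.re : ℂ) + (η : ℂ) * Complex.I)) - ntr A‖)
      (nhdsWithin 0 (Set.Ioi 0)) (nhds (b.im ^ 2 / 2 * ‖b - ntr A‖)) :=
    ((((Complex.continuous_im.tendsto b).comp hlim).pow 2).div_const 2).mul
      (hlim.sub_const _).norm
  have hR : Tendsto (fun η : ℝ => ‖((w.re : ℂ) + (η : ℂ) * Complex.I) - w‖)
      (nhdsWithin 0 (Set.Ioi 0)) (nhds ‖((w.re : ℂ) + ((0 : ℝ) : ℂ) * Complex.I) - w‖) :=
    ((by fun_prop : Continuous fun η : ℝ => ‖((w.re : ℂ) + (η : ℂ) * Complex.I) - w‖).tendsto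
      0).mono_left nhdsWithin_le_nhds
  have hle : b.im ^ 2 / 2 * ‖b - ntr A‖ ≤ ‖((w.re : ℂ) + ((0 : ℝ) : ℂ) * Complex.I) - w‖ := by
    refine le_of_tendsto_of_tendsto hL hR ?_
    filter_upwards [self_mem_nhdsWithin] with η hη
    have hη : 0 < η := hη
    exact (hG _ (by simpa using hη.ne')).sq_im_mul_norm_ntr_sub_le hH h
      (by simpa using mul_pos hη hw)
  have hnorm : ‖((w.re : ℂ) + ((0 : ℝ) : ℂ) * Complex.I) - w‖ = |w.im| := by
    have : ((w.re : ℂ) + ((0 : ℝ) : ℂ) * Complex.I) - w = ((-w.im : ℝ) : ℂ) * Complex.I := by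
      apply Complex.ext <;> simp
    rw [this]; simp
  rw [hnorm] at hle
  have h1 : δ ^ 2 / 2 * ‖b - ntr A‖ ≤ |w.im| := by
    refine le_trans ?_ hle
    gcongr
  have h2 : ‖b - ntr A‖ ≤ 2 * |w.im| / δ ^ 2 := by
    rw [le_div_iff₀ (by positivity)]; linarith
  have h3 : b.im - (ntr A).im ≤ ‖b - ntr A‖ := by
    simpa using (le_abs_self _).trans (Complex.abs_im_le_norm (b - ntr A))
  linarith [le_abs_self (ntr A).im]

/-- In the bulk, `1 - ⟨A₁A₂⟩` is of order one for spectral parameters in the same half-plane. -/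
lemma le_norm_one_sub_ntr_mul_of_tendsto (hH : H.IsHermitian) (h₁ : IsDysonResolvent H w₁ A₁)
    (h₂ : IsDysonResolvent H w₂ A₂) (hw : 0 < w₁.im * w₂.im)
    {G : ℂ → Matrix n n ℂ} (hG : ∀ z : ℂ, z.im ≠ 0 → IsDysonResolvent H z (G z)) {b : ℂ} {δ : ℝ}
    (hδ : 0 < δ) (hb : δ ≤ b.im)
    (hlim : Tendsto (fun η : ℝ => ntr (G ((w₁.re : ℂ) + (η : ℂ) * Complex.I)))
      (nhdsWithin 0 (Set.Ioi 0)) (nhds b)) :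
    min (δ ^ 2 / 8) (min (δ ^ 3 / 4) 1 / 4) ≤ ‖1 - ntr (A₁ * A₂)‖ := by
  rcases le_total |w₁.im| (δ ^ 3 / 4) with hη | hη
  · refine (min_le_left _ _).trans (le_trans ?_ (h₁.sq_im_le_norm_one_sub_ntr_mul hH h₂ hw))
    have h3 := h₁.le_abs_im_ntr_of_tendsto hH hG hδ hb hlim
    have h4 : 2 * |w₁.im| / δ ^ 2 ≤ δ / 2 := by
      rw [div_le_iff₀ (by positivity)]; nlinarith
    rw [← sq_abs (ntr A₁).im]
    nlinarith
  · refine (min_le_right _ _).trans (le_trans ?_ (h₁.min_abs_im_le hH h₂))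
    have : min (δ ^ 3 / 4) 1 ≤ min |w₁.im| 1 := min_le_min_right _ hη
    have : 0 ≤ min |w₂.im| 1 := by positivity
    linarith

end IsDysonResolvent

section Chiral

variable {N : ℕ} {Λ : Matrix (Fin N) (Fin N) ℂ} {w w₁ w₂ : ℂ} {A A₁ A₂ : Mat2 N}

lemma Em_mul_Em (N : ℕ) : Em N * Em N = 1 := by
  simp [Em, Matrix.fromBlocks_multiply]

lemma Em_conjTranspose (N : ℕ) : (Em N)ᴴ = Em N := by
  simp [Em, Matrix.fromBlocks_conjTranspose]

lemma ntr_Em (N : ℕ) : ntr (Em N) = 0 := by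
  simp [ntr, Em, Matrix.trace, Fintype.sum_sum_type]

lemma herm_isHermitian (Λ : Matrix (Fin N) (Fin N) ℂ) : (herm Λ).IsHermitian := by
  simp [Matrix.IsHermitian, herm, Matrix.fromBlocks_conjTranspose]

lemma herm_mul_Em (Λ : Matrix (Fin N) (Fin N) ℂ) : herm Λ * Em N = -(Em N * herm Λ) := by
  simp [herm, Em, Matrix.fromBlocks_multiply, Matrix.fromBlocks_neg]

/-- Solutions of the Dyson equation have no component along `E₋`. -/
lemma ntr_mul_Em_eq_zero (hw : w.im ≠ 0)
    (h : A * (w • (1 : Mat2 N) - herm Λ + Sop N A) = -1) : ntr (A * Em N) = 0 := by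
  set m := ntr A with hm
  set u := ntr (A * Em N) with hu
  have hQ : A * (w • (1 : Mat2 N) - herm Λ + (m • 1 - u • Em N)) = -1 := h
  have hQ' : (w • (1 : Mat2 N) - herm Λ + (m • 1 - u • Em N)) * A = -1 := by
    have := mul_eq_one_comm.mp (show (-A) *
      (w • (1 : Mat2 N) - herm Λ + (m • 1 - u • Em N)) = 1 by rw [neg_mul, hQ, neg_neg])
    rwa [mul_neg, neg_eq_iff_eq_neg] at this
  have h1 := congrArg (fun X => ntr (X * Em N)) hQ
  have h2 := congrArg (fun X => ntr (Em N * X)) hQ'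
  have hEA : ntr (Em N * A) = u := ntr_mul_comm _ _
  have hflip : ntr (Em N * (herm Λ * A)) = - ntr (A * herm Λ * Em N) := by
    rw [mul_assoc A, herm_mul_Em, mul_neg, ntr_neg, neg_neg, ntr_mul_comm A, mul_assoc]
  simp only [mul_add, mul_sub, add_mul, sub_mul, Matrix.mul_smul, Matrix.smul_mul, mul_one,
    one_mul, ntr_add, ntr_sub, ntr_smul, mul_assoc, Em_mul_Em, neg_mul, mul_neg, ntr_neg,
    ntr_Em] at h1 h2 hflip
  rw [← mul_assoc (Em N) (Em N), Em_mul_Em, one_mul, hEA, hflip] at h2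
  rw [← hu, ← hm] at h1
  have h3 : 2 * w * u = 0 := by linear_combination h1 + h2
  have hw0 : w ≠ 0 := by rintro rfl; simp at hw
  simpa [hw0] using h3

lemma im_mul_im_ntr_pos [NeZero N] (h : (w.im • matIm A).PosDef) : 0 < w.im * (ntr A).im := by
  have h1 := h.trace_pos
  have hc : (0 : ℝ) < Fintype.card (Idx N) := by exact_mod_cast Fintype.card_pos
  have h2 : (w.im • matIm A).trace = ((w.im * (A.trace).im : ℝ) : ℂ) := by
    rw [Matrix.trace_smul, matIm, Matrix.trace_smul, Matrix.trace_sub,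
      Matrix.trace_conjTranspose]
    have h3 : A.trace - star A.trace = 2 * Complex.I * (A.trace.im : ℂ) := by
      rw [Complex.star_def, Complex.sub_conj]; push_cast; ring
    rw [h3, smul_eq_mul, inv_mul_cancel_left₀ (by simp), Complex.real_smul]
    push_cast
    rfl
  rw [h2] at h1
  have h3 : 0 < w.im * (A.trace).im := by exact_mod_cast h1
  have h4 : (ntr A).im = (Fintype.card (Idx N) : ℝ)⁻¹ * (A.trace).im := by
    simp only [ntr]
    rw [← Complex.ofReal_natCast, ← Complex.ofReal_inv, Complex.im_ofReal_mul]
  rw [h4, mul_left_comm]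
  positivity

lemma IsMDESolution.isDysonResolvent [NeZero N] {M : ℂ → Mat2 N} (hM : IsMDESolution N Λ M)
    (hw : w.im ≠ 0) : IsDysonResolvent (herm Λ) w (M w) where
  mul_eq_one := by
    have h := (hM w hw).1
    have hu := ntr_mul_Em_eq_zero hw h
    rw [Sop, hu, zero_smul, sub_zero] at h
    have e : herm Λ - (w + ntr (M w)) • (1 : Mat2 N) =
        -(w • 1 - herm Λ + ntr (M w) • 1) := by
      rw [add_smul]; abel
    rw [e, mul_neg, h, neg_neg]
  im_pos := im_mul_im_ntr_pos (hM w hw).2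

lemma IsDysonResolvent.flip (h : IsDysonResolvent (herm Λ) w A) :
    IsDysonResolvent (herm Λ) (-w) (-(Em N * A * Em N)) := by
  have htr : ntr (-(Em N * A * Em N)) = -ntr A := by
    rw [ntr_neg, ntr_mul_comm, ← mul_assoc, Em_mul_Em, one_mul]
  refine ⟨?_, by simpa [htr] using h.im_pos⟩
  have e : Em N * (herm Λ - (-w + -ntr A) • 1) = -((herm Λ - (w + ntr A) • 1) * Em N) := by
    rw [sub_mul, herm_mul_Em, mul_sub, Matrix.mul_smul, Matrix.smul_mul, mul_one, one_mul,
      ← neg_add, neg_smul]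
    abel
  rw [htr, neg_mul, mul_assoc, e, mul_neg, neg_neg, mul_assoc, ← mul_assoc A, h.mul_eq_one,
    one_mul, Em_mul_Em]

lemma ntr_Em_mul_herm_mul_eq_zero {Z : Mat2 N} (hZ : Commute (herm Λ) Z) :
    ntr (Em N * (herm Λ * Z)) = 0 := by
  have h : ntr (Em N * (herm Λ * Z)) = -ntr (Em N * (herm Λ * Z)) := by
    conv_lhs => rw [hZ.eq, ← mul_assoc, ntr_mul_comm, ← mul_assoc, herm_mul_Em, neg_mul, ntr_neg,
      mul_assoc]
  linear_combination h / 2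

lemma IsDysonResolvent.commute (h : IsDysonResolvent (herm Λ) w A) : Commute (herm Λ) A := by
  have h1 := h.mul_eq_one.trans h.sub_mul_eq_one.symm
  rw [mul_sub, sub_mul, Matrix.mul_smul, Matrix.smul_mul, mul_one, one_mul] at h1
  exact (sub_left_injective h1).symm

lemma IsDysonResolvent.smul_eq (h : IsDysonResolvent (herm Λ) w A) :
    (w + ntr A) • A = herm Λ * A - 1 := by
  rw [← h.sub_mul_eq_one, sub_mul, Matrix.smul_mul, one_mul]; abel

lemma IsDysonResolvent.add_ntr_ne_zero (h : IsDysonResolvent (herm Λ) w A) : w + ntr A ≠ 0 := by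
  intro h0
  have h1 := congrArg Complex.im h0
  simp only [Complex.add_im, Complex.zero_im] at h1
  nlinarith [h.im_pos, sq_nonneg w.im, sq_nonneg (ntr A).im]

lemma IsDysonResolvent.ntr_Em_mul_mul_eq_zero (h₁ : IsDysonResolvent (herm Λ) w₁ A₁)
    (h₂ : IsDysonResolvent (herm Λ) w₂ A₂) : ntr (Em N * (A₁ * A₂)) = 0 := by
  have hc : Commute (herm Λ) (A₁ * (herm Λ * A₂) - A₁ - A₂) :=
    ((h₁.commute.mul_right ((Commute.refl _).mul_right h₂.commute)).sub_right
      h₁.commute).sub_right h₂.commute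
  have e : ((w₁ + ntr A₁) * (w₂ + ntr A₂)) • (A₁ * A₂) =
      herm Λ * (A₁ * (herm Λ * A₂) - A₁ - A₂) + 1 := by
    rw [← smul_mul_smul_comm, h₁.smul_eq, h₂.smul_eq]
    noncomm_ring
  have h3 := congrArg (fun X => ntr (Em N * X)) e
  simp only [mul_add (Em N), Matrix.mul_smul, ntr_smul, ntr_add, mul_one, ntr_Em,
    ntr_Em_mul_herm_mul_eq_zero hc, add_zero] at h3
  exact (mul_eq_zero.mp h3).resolve_left (mul_ne_zero h₁.add_ntr_ne_zero h₂.add_ntr_ne_zero)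

lemma IsDysonResolvent.ntr_mul_mul_Em_eq_zero (h₁ : IsDysonResolvent (herm Λ) w₁ A₁)
    (h₂ : IsDysonResolvent (herm Λ) w₂ A₂) : ntr (A₁ * A₂ * Em N) = 0 := by
  rw [ntr_mul_comm, h₁.ntr_Em_mul_mul_eq_zero h₂]

lemma IsDysonResolvent.ntr_mul_Em_mul_eq_zero (h₁ : IsDysonResolvent (herm Λ) w₁ A₁)
    (h₂ : IsDysonResolvent (herm Λ) w₂ A₂) : ntr (A₁ * Em N * A₂) = 0 := by
  rw [mul_assoc, ntr_mul_comm, mul_assoc, h₂.ntr_Em_mul_mul_eq_zero h₁]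

lemma one_sub_ntr_mul_flip (A₁ A₂ : Mat2 N) :
    1 - ntr (A₁ * -(Em N * A₂ * Em N)) = 1 + ntr (A₁ * Em N * A₂ * Em N) := by
  rw [mul_neg, ntr_neg, sub_neg_eq_add]
  simp only [mul_assoc]

lemma IsDysonResolvent.bijective_stability (h₁ : IsDysonResolvent (herm Λ) w₁ A₁)
    (h₂ : IsDysonResolvent (herm Λ) w₂ A₂) (hp : 1 - ntr (A₁ * A₂) ≠ 0)
    (hm : 1 + ntr (A₁ * Em N * A₂ * Em N) ≠ 0) :
    Function.Bijective (fun T : Mat2 N => T - A₁ * Sop N T * A₂) := by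
  let B : Mat2 N →ₗ[ℂ] Mat2 N :=
    { toFun := fun T => T - A₁ * Sop N T * A₂
      map_add' := fun T U => by
        have : Sop N (T + U) = Sop N T + Sop N U := by
          simp only [Sop, ntr_add, add_mul, add_smul]; abel
        rw [this]; noncomm_ring
      map_smul' := fun c T => by
        have : Sop N (c • T) = c • Sop N T := by
          simp only [Sop, ntr_smul, Matrix.smul_mul, mul_smul, smul_sub]
        rw [this]; simp [smul_sub] }
  have hinj : Function.Injective B := by
    rw [injective_iff_map_eq_zero]
    intro T hT
    have hT' : T = A₁ * Sop N T * A₂ := sub_eq_zero.mp hT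
    have hexp : A₁ * Sop N T * A₂ = ntr T • (A₁ * A₂) - ntr (T * Em N) • (A₁ * Em N * A₂) := by
      simp [Sop, mul_sub, sub_mul]
    rw [hexp] at hT'
    have e1 := congrArg ntr hT'
    have e2 := congrArg (fun X => ntr (X * Em N)) hT'
    simp only [sub_mul, Matrix.smul_mul, ntr_sub, ntr_smul, h₁.ntr_mul_mul_Em_eq_zero h₂,
      h₁.ntr_mul_Em_mul_eq_zero h₂] at e1 e2
    have t0 : ntr T = 0 :=
      (mul_eq_zero.mp (show (1 - ntr (A₁ * A₂)) * ntr T = 0 by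
        linear_combination e1)).resolve_left hp
    have u0 : ntr (T * Em N) = 0 :=
      (mul_eq_zero.mp (show (1 + ntr (A₁ * Em N * A₂ * Em N)) * ntr (T * Em N) = 0 by
        linear_combination e2)).resolve_left hm
    rw [hT', t0, u0]; simp
  exact ⟨hinj, LinearMap.injective_iff_surjective.mp hinj⟩

end Chiral

/-- **Spectral properties of the two-body stability operator**
`B = 1 − M₁S[·]M₂` (Appendix B):
(a) eigenvalue `1` on the codimension-two subspace `{⟨T⟩ = ⟨TE₋⟩ = 0}`, and the
two nontrivial eigenvalues `β_± = 1 ∓ ⟨M₁E_±M₂E_±⟩` with right eigenvectors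
`R_± = M₁E_±M₂` and left eigenvectors `L_± = E_±`;
(b) `|β_±| ≳ (|Re w₁ ∓ Re w₂| + |Im w₁| + |Im w₂|) ∧ 1`, and `B` is invertible;
(c) in the bulk, `|β_{−s}| ≳ 1` for `s = −sgn(Im w₁·Im w₂)`. -/
theorem stability_operator_spectrum
    (Λ : (N : ℕ) → Matrix (Fin N) (Fin N) ℂ)
    (CΛ : ℝ) (hΛ : ∀ N, opNorm (Λ N) ≤ CΛ)
    (M : (N : ℕ) → ℂ → Mat2 N) (hM : ∀ N, IsMDESolution N (Λ N) (M N))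
    (mB : (N : ℕ) → ℝ → ℂ)
    (hmB : ∀ (N : ℕ) (e : ℝ),
      Tendsto (fun η : ℝ => ntr (M N ((e : ℂ) + (η : ℂ) * Complex.I)))
        (nhdsWithin 0 (Set.Ioi 0)) (nhds (mB N e)))
    (ρ : (N : ℕ) → ℝ → ℝ) (hρ : ∀ N e, ρ N e = (mB N e).im / Real.pi) :
    -- (a) eigenvalue equations
    (∀ (N : ℕ) (w₁ w₂ : ℂ), w₁.im ≠ 0 → w₂.im ≠ 0 →
      -- B acts as the identity on {⟨T⟩ = ⟨TE₋⟩ = 0} ((2N)²−2 eigenvalues 1)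
      (∀ T : Mat2 N, ntr T = 0 → ntr (T * Em N) = 0 →
        M N w₁ * Sop N T * M N w₂ = 0) ∧
      -- right eigenvectors R_± = M₁E_±M₂
      (M N w₁ * M N w₂ - M N w₁ * Sop N (M N w₁ * M N w₂) * M N w₂ =
        (1 - ntr (M N w₁ * M N w₂)) • (M N w₁ * M N w₂)) ∧
      (M N w₁ * Em N * M N w₂ -
          M N w₁ * Sop N (M N w₁ * Em N * M N w₂) * M N w₂ =
        (1 + ntr (M N w₁ * Em N * M N w₂ * Em N)) • (M N w₁ * Em N * M N w₂)) ∧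
      -- left eigenvectors L_± = E_± (for the adjoint B*[T] = T − S[M₁*TM₂*])
      ((1 : Mat2 N) - Sop N ((M N w₁)ᴴ * (M N w₂)ᴴ) =
        (starRingEnd ℂ (1 - ntr (M N w₁ * M N w₂))) • (1 : Mat2 N)) ∧
      (Em N - Sop N ((M N w₁)ᴴ * Em N * (M N w₂)ᴴ) =
        (starRingEnd ℂ (1 + ntr (M N w₁ * Em N * M N w₂ * Em N))) • Em N)) ∧
    -- (b) lower bounds on β_± and invertibility of B
    (∃ c : ℝ, 0 < c ∧ ∀ (N : ℕ) (w₁ w₂ : ℂ), w₁.im ≠ 0 → w₂.im ≠ 0 →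
      (c * min (|w₁.re - w₂.re| + |w₁.im| + |w₂.im|) 1 ≤
        ‖1 - ntr (M N w₁ * M N w₂)‖) ∧
      (c * min (|w₁.re + w₂.re| + |w₁.im| + |w₂.im|) 1 ≤
        ‖1 + ntr (M N w₁ * Em N * M N w₂ * Em N)‖) ∧
      Function.Bijective
        (fun T : Mat2 N => T - M N w₁ * Sop N T * M N w₂)) ∧
    -- (c) in the bulk the eigenvalue β_{−s} is of order one
    (∀ κ : ℝ, 0 < κ → ∃ c : ℝ, 0 < c ∧
      ∀ (N : ℕ) (w₁ w₂ : ℂ), w₁.im ≠ 0 → w₂.im ≠ 0 →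
        κ ^ ((1 : ℝ)/3) ≤ ρ N w₁.re → κ ^ ((1 : ℝ)/3) ≤ ρ N w₂.re →
        c ≤ ‖if 0 < w₁.im * w₂.im then 1 - ntr (M N w₁ * M N w₂)
             else 1 + ntr (M N w₁ * Em N * M N w₂ * Em N)‖) := by
  
  refine ⟨?_, ⟨1 / 7, by norm_num, ?_⟩, ?_⟩
  · intro N w₁ w₂ hw₁ hw₂
    refine ⟨fun T h0 h1 => by simp [Sop, h0, h1], ?_⟩
    rcases Nat.eq_zero_or_pos N with rfl | hN
    · exact ⟨Subsingleton.elim _ _, Subsingleton.elim _ _, Subsingleton.elim _ _,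
        Subsingleton.elim _ _⟩
    have : NeZero N := ⟨hN.ne'⟩
    have h₁ := (hM N).isDysonResolvent hw₁
    have h₂ := (hM N).isDysonResolvent hw₂
    have c1 : ntr ((M N w₁)ᴴ * (M N w₂)ᴴ) = starRingEnd ℂ (ntr (M N w₁ * M N w₂)) := by
      rw [← Matrix.conjTranspose_mul, ntr_conjTranspose, ntr_mul_comm]
    have c2 : ntr ((M N w₁)ᴴ * (M N w₂)ᴴ * Em N) = 0 := by
      conv_lhs => rw [← Em_conjTranspose N, ← Matrix.conjTranspose_mul,
        ← Matrix.conjTranspose_mul, ntr_conjTranspose, h₂.ntr_Em_mul_mul_eq_zero h₁, map_zero]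
    have c3 : ntr ((M N w₁)ᴴ * Em N * (M N w₂)ᴴ) = 0 := by
      conv_lhs => rw [← Em_conjTranspose N, mul_assoc, ← Matrix.conjTranspose_mul,
        ← Matrix.conjTranspose_mul, ntr_conjTranspose, h₂.ntr_mul_Em_mul_eq_zero h₁, map_zero]
    have c4 : ntr ((M N w₁)ᴴ * Em N * (M N w₂)ᴴ * Em N) =
        starRingEnd ℂ (ntr (M N w₁ * Em N * M N w₂ * Em N)) := by
      have e : (M N w₁)ᴴ * Em N * (M N w₂)ᴴ * Em N =
          (Em N * (M N w₂ * (Em N * M N w₁)))ᴴ := by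
        simp only [Matrix.conjTranspose_mul, Em_conjTranspose, mul_assoc]
      rw [e, ntr_conjTranspose, ← mul_assoc, ← mul_assoc, ntr_mul_comm]
      simp only [mul_assoc]
    refine ⟨?_, ?_, ?_, ?_⟩
    · rw [Sop, h₁.ntr_mul_mul_Em_eq_zero h₂]
      simp [sub_smul]
    · rw [Sop, h₁.ntr_mul_Em_mul_eq_zero h₂]
      simp [add_smul]
    · rw [Sop, c1, c2]
      simp [sub_smul]
    · rw [Sop, c3, c4]
      simp [add_smul]
  · intro N w₁ w₂ hw₁ hw₂
    rcases Nat.eq_zero_or_pos N with rfl | hN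
    · have hmin : ∀ x : ℝ, (7 : ℝ)⁻¹ * min x 1 ≤ 1 := fun x => by linarith [min_le_right x 1]
      refine ⟨by simpa [ntr] using hmin _, by simpa [ntr] using hmin _,
        fun _ _ _ => Subsingleton.elim _ _, fun _ => ⟨0, Subsingleton.elim _ _⟩⟩
    have : NeZero N := ⟨hN.ne'⟩
    have h₁ := (hM N).isDysonResolvent hw₁
    have h₂ := (hM N).isDysonResolvent hw₂
    have hp := h₁.le_norm_one_sub_ntr_mul (herm_isHermitian _) h₂
    have hm := h₁.le_norm_one_sub_ntr_mul (herm_isHermitian _) h₂.flip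
    rw [one_sub_ntr_mul_flip] at hm
    simp only [Complex.neg_re, Complex.neg_im, abs_neg, sub_neg_eq_add] at hm
    have hpos : ∀ x : ℝ, 0 < 1 / 7 * min (|x| + |w₁.im| + |w₂.im|) 1 := fun x => by
      have := abs_pos.mpr hw₁
      positivity
    exact ⟨hp, hm, h₁.bijective_stability h₂ (norm_pos_iff.mp ((hpos _).trans_le hp))
      (norm_pos_iff.mp ((hpos _).trans_le hm))⟩
  · intro κ hκ
    set δ : ℝ := Real.pi * κ ^ ((1 : ℝ) / 3) with hδ_def
    have hδ : 0 < δ := by positivity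
    refine ⟨min (δ ^ 2 / 8) (min (δ ^ 3 / 4) 1 / 4), by positivity, ?_⟩
    intro N w₁ w₂ hw₁ hw₂ hρ₁ _
    rcases Nat.eq_zero_or_pos N with rfl | hN
    · have hmB0 : mB 0 w₁.re = 0 := by
        refine tendsto_nhds_unique (hmB 0 w₁.re) ?_
        simp [ntr]
      rw [hρ, hmB0, Complex.zero_im, zero_div] at hρ₁
      exact absurd hρ₁ (not_le.mpr (by positivity))
    have : NeZero N := ⟨hN.ne'⟩
    have h₁ := (hM N).isDysonResolvent hw₁
    have h₂ := (hM N).isDysonResolvent hw₂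
    have hb : δ ≤ (mB N w₁.re).im := by
      rw [hρ, le_div_iff₀ Real.pi_pos] at hρ₁
      rw [hδ_def]; linarith
    split_ifs with hs
    · exact h₁.le_norm_one_sub_ntr_mul_of_tendsto (herm_isHermitian _) h₂ hs
        (fun z hz => (hM N).isDysonResolvent hz) hδ hb (hmB N w₁.re)
    · have hs' : 0 < w₁.im * (-w₂).im := by
        have := lt_of_le_of_ne (not_lt.mp hs) (mul_ne_zero hw₁ hw₂)
        simpa using this
      rw [← one_sub_ntr_mul_flip]
      exact h₁.le_norm_one_sub_ntr_mul_of_tendsto (herm_isHermitian _) h₂.flip hs'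
        (fun z hz => (hM N).isDysonResolvent hz) hδ hb (hmB N w₁.re)
end
end
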